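/- arXiv:1703.05376 — 5 statements merged into one kernel-verified Lean document; each statement's English description precedes it below -/
import Mathlib

section
/- Let n0 ≥ 1 be an integer, B > 0, p ∈ (0,1), and κ ∈ (0,1). Then ∑_{n=n0}^∞ exp(−B n^p) ≤ (2/(B(1−κ)p)) · ((1−p)/(Bκp))^{(1−p)/p} · exp( B(2−κ) − (1−p)/p − B(1−κ) n0^p ). -/
open Real

/-- The function `u ↦ u ^ q * exp (-a * u)` is at most its value at `u = q / a`. -/
lemma rpow_mul_exp_neg_mul_le {a q u : ℝ} (ha : 0 < a) (hq : 0 < q) (hu : 0 < u) :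
    u ^ q * exp (-a * u) ≤ (q / a) ^ q * exp (-q) := by
  have hqa : 0 < q / a := div_pos hq ha
  rw [rpow_def_of_pos hu, rpow_def_of_pos hqa, ← exp_add, ← exp_add, exp_le_exp]
  have h := log_le_sub_one_of_pos (div_pos hu hqa)
  rw [log_div hu.ne' hqa.ne'] at h
  have h₁ := mul_le_mul_of_nonneg_left h hq.le
  have h₂ : q * (u / (q / a)) = a * u := by field_simp
  nlinarith

/-- A telescoping bound for `exp (-B * x ^ p)`, coming from the mean value theorem applied to
`exp (-c * x ^ p)` with `c = B * (1 - κ)`. -/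
lemma exp_neg_mul_rpow_le_sub {B p κ x : ℝ} (hB : 0 < B) (hp : p ∈ Set.Ioo (0 : ℝ) 1)
    (hκ : κ ∈ Set.Ioo (0 : ℝ) 1) (hx : 1 ≤ x) :
    exp (-B * x ^ p) ≤ exp B / (B * (1 - κ) * p) *
      (((1 - p) / (B * κ * p)) ^ ((1 - p) / p) * exp (-((1 - p) / p))) *
      (exp (-(B * (1 - κ)) * x ^ p) - exp (-(B * (1 - κ)) * (x + 1) ^ p)) := by
  obtain ⟨hp0, hp1⟩ := hp
  obtain ⟨hκ0, hκ1⟩ := hκ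
  have hκ' : 0 < 1 - κ := by linarith
  have hx0 : 0 < x := by linarith
  have hderiv : ∀ y : ℝ, 0 < y → HasDerivAt (fun y : ℝ => exp (-(B * (1 - κ)) * y ^ p))
      (exp (-(B * (1 - κ)) * y ^ p) * (-(B * (1 - κ)) * (p * y ^ (p - 1)))) y := fun y hy =>
    ((hasDerivAt_rpow_const (Or.inl hy.ne')).const_mul _).exp
  obtain ⟨y, ⟨hxy, hyx⟩, hy⟩ := exists_hasDerivAt_eq_slope
    (fun y : ℝ => exp (-(B * (1 - κ)) * y ^ p)) _ (lt_add_one x)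
    (fun y hy => (hderiv y (hx0.trans_le hy.1)).continuousAt.continuousWithinAt)
    (fun y hy => hderiv y (hx0.trans hy.1))
  have hy0 : 0 < y := hx0.trans hxy
  have hdiff : exp (-(B * (1 - κ)) * x ^ p) - exp (-(B * (1 - κ)) * (x + 1) ^ p)
      = B * (1 - κ) * p * (y ^ (p - 1) * exp (-(B * (1 - κ)) * y ^ p)) := by
    rw [add_sub_cancel_left, div_one] at hy
    linarith
  have hyp : y ^ p ≤ x ^ p + 1 := by
    calc y ^ p ≤ (x + 1) ^ p := rpow_le_rpow hy0.le hyx.le hp0.le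
      _ ≤ x ^ p + 1 ^ p := rpow_add_le_add_rpow hx0.le zero_le_one hp0.le hp1.le
      _ = x ^ p + 1 := by rw [one_rpow]
  have hmax := rpow_mul_exp_neg_mul_le (mul_pos hB hκ0) (div_pos (sub_pos.2 hp1) hp0)
    (rpow_pos_of_pos hy0 p)
  rw [← rpow_mul hy0.le, mul_div_cancel₀ _ hp0.ne', div_div, mul_comm p (B * κ)] at hmax
  rw [hdiff]
  calc exp (-B * x ^ p) ≤ exp (B + -B * y ^ p) := by
        rw [exp_le_exp]
        nlinarith
    _ = exp B * (y ^ (1 - p) * exp (-(B * κ) * y ^ p)) *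
          (y ^ (p - 1) * exp (-(B * (1 - κ)) * y ^ p)) := by
        have h₁ : y ^ (1 - p) * y ^ (p - 1) = 1 := by
          rw [← rpow_add hy0, sub_add_sub_cancel, sub_self, rpow_zero]
        have h₂ : exp (B + -B * y ^ p)
            = exp B * (exp (-(B * κ) * y ^ p) * exp (-(B * (1 - κ)) * y ^ p)) := by
          rw [← exp_add, ← exp_add]
          ring_nf
        rw [h₂]
        linear_combination
          -(exp B * (exp (-(B * κ) * y ^ p) * exp (-(B * (1 - κ)) * y ^ p))) * h₁
    _ ≤ exp B * (((1 - p) / (B * κ * p)) ^ ((1 - p) / p) * exp (-((1 - p) / p))) *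
          (y ^ (p - 1) * exp (-(B * (1 - κ)) * y ^ p)) := by gcongr
    _ = _ := by
        field_simp

/-- **A bound for sub-exponential series.**
For any integer `n0 ≥ 1`, `B > 0`, `p ∈ (0,1)` and `κ ∈ (0,1)`,
`∑_{n=n0}^∞ exp(−B n^p) ≤ (2/(B(1−κ)p)) ((1−p)/(Bκp))^((1−p)/p)
  exp(B(2−κ) − (1−p)/p − B(1−κ) n0^p)`. -/
theorem subexponential_series_bound
    (n0 : ℕ) (hn0 : 1 ≤ n0) (B p κ : ℝ)
    (hB : 0 < B) (hp : p ∈ Set.Ioo (0:ℝ) 1) (hκ : κ ∈ Set.Ioo (0:ℝ) 1) :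
    (∑' n : {k : ℕ // n0 ≤ k}, Real.exp (-B * (n : ℝ) ^ p))
      ≤ (2 / (B * (1 - κ) * p)) * ((1 - p) / (B * κ * p)) ^ ((1 - p) / p)
        * Real.exp (B * (2 - κ) - (1 - p) / p - B * (1 - κ) * (n0 : ℝ) ^ p) := by
  have hp' : 0 < 1 - p := sub_pos.2 hp.2
  have hκ' : 0 < 1 - κ := sub_pos.2 hκ.2
  have hp0 := hp.1
  have hκ0 := hκ.1
  let e : ℕ ≃ {k : ℕ // n0 ≤ k} :=
    { toFun := fun n => ⟨n0 + n, Nat.le_add_right _ _⟩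
      invFun := fun k => k - n0
      left_inv := fun n => Nat.add_sub_cancel_left _ _
      right_inv := fun k => Subtype.ext (Nat.add_sub_of_le k.2) }
  rw [← e.tsum_eq]
  set K : ℝ := exp B / (B * (1 - κ) * p) *
    (((1 - p) / (B * κ * p)) ^ ((1 - p) / p) * exp (-((1 - p) / p))) with hK
  have hK0 : 0 ≤ K := by positivity
  let F : ℕ → ℝ := fun n => exp (-(B * (1 - κ)) * ((n0 + n : ℕ) : ℝ) ^ p)
  have hterm : ∀ n : ℕ, exp (-B * ((e n : ℕ) : ℝ) ^ p) ≤ K * (F n - F (n + 1)) := by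
    intro n
    have h := exp_neg_mul_rpow_le_sub (x := ((n0 + n : ℕ) : ℝ)) hB hp hκ
      (by exact_mod_cast hn0.trans (Nat.le_add_right _ _))
    simpa [F, e, hK, add_assoc] using h
  calc ∑' n : ℕ, exp (-B * ((e n : ℕ) : ℝ) ^ p) ≤ K * F 0 := by
        refine Real.tsum_le_of_sum_range_le (fun n => (exp_pos _).le) fun N => ?_
        calc ∑ n ∈ Finset.range N, exp (-B * ((e n : ℕ) : ℝ) ^ p)
            ≤ ∑ n ∈ Finset.range N, K * (F n - F (n + 1)) :=
              Finset.sum_le_sum fun n _ => hterm n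
          _ = K * (F 0 - F N) := by rw [← Finset.mul_sum, Finset.sum_range_sub']
          _ ≤ K * F 0 := by
              gcongr
              exact sub_le_self _ (exp_pos _).le
    _ = 1 / (B * (1 - κ) * p) * ((1 - p) / (B * κ * p)) ^ ((1 - p) / p)
          * exp (B - (1 - p) / p - B * (1 - κ) * (n0 : ℝ) ^ p) := by
        have h : exp (B - (1 - p) / p - B * (1 - κ) * (n0 : ℝ) ^ p)
            = exp B * exp (-((1 - p) / p)) * exp (-(B * (1 - κ)) * (n0 : ℝ) ^ p) := by
          rw [← exp_add, ← exp_add]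
          ring_nf
        simp only [h, hK, F, add_zero]
        ring
    _ ≤ _ := by
        gcongr
        · norm_num
        · nlinarith
end

section
/- Let p ∈ (0,1), q̂ > 0, c > 0, κ ∈ (0,1), ε > 0, and n0 ≥ 1 an integer. For n ≥ 1 set c_n := ∑_{k=0}^{n−1} (k+1)^{−2p} · exp(−2q̂ ∑_{i=k+1}^{n−1} (i+1)^{−p}). Then there exists a constant K_g ≥ 1, depending only on p and q̂ (not on c, κ, ε, n0), such that ∑_{n ≥ n0} exp(−c ε² / c_n) ≤ (c7 / ε^{2/p}) · exp(c5 ε²) · exp(−c6 ε² n0^p), where c5 := c q̂ (2−κ)/(K_g e^{q̂}), c6 := c q̂ (1−κ)/(K_g e^{q̂}), and c7 := 2 (K_g e^{q̂}/(c q̂))^{1/p} · (1/((1−κ) p^{1/p})) · ((1−p)/(eκ))^{(1−p)/p}. -/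
open Real Finset

/-- `cSum p q n = ∑_{k<n} (k+1)^{-2p} exp(-2q ∑_{k<i<n} (i+1)^{-p})`. -/
noncomputable def cSum (p q : ℝ) (n : ℕ) : ℝ :=
  ∑ k ∈ Finset.range n, ((k : ℝ) + 1) ^ (-(2 * p)) *
    Real.exp (-(2 * q) * ∑ i ∈ Finset.Ico (k + 1) n, ((i : ℝ) + 1) ^ (-p))

lemma cSum_succ (p q : ℝ) (n : ℕ) :
    cSum p q (n + 1) =
      Real.exp (-(2 * q) * ((n : ℝ) + 1) ^ (-p)) * cSum p q n + ((n : ℝ) + 1) ^ (-(2 * p)) := by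
  unfold cSum
  rw [Finset.sum_range_succ]
  congr 1
  · rw [Finset.mul_sum]
    refine Finset.sum_congr rfl fun k hk => ?_
    rw [Finset.sum_Ico_succ_top (Finset.mem_range.mp hk), mul_add, Real.exp_add]
    ring
  · simp

lemma cSum_pos (p q : ℝ) {n : ℕ} (hn : 1 ≤ n) : 0 < cSum p q n := by
  unfold cSum
  exact Finset.sum_pos (fun k _ => by positivity) ⟨0, Finset.mem_range.mpr hn⟩

/-- For large `n` the contraction factor of the recursion beats the growth of `n ^ p`. -/
lemma eventually_contraction {p q : ℝ} (hp : p ∈ Set.Ioo (0 : ℝ) 1) (hq : 0 < q) :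
    ∀ᶠ n : ℕ in Filter.atTop, p / n ≤ q * ((n : ℝ) + 1) ^ (-p) := by
  obtain ⟨hp0, hp1⟩ := hp
  have ht := (tendsto_rpow_atTop (sub_pos.mpr hp1)).comp
    (tendsto_natCast_atTop_atTop (R := ℝ))
  filter_upwards [ht.eventually_ge_atTop (2 / q), Filter.eventually_ge_atTop 1] with n hn hn1
  have hn1' : (1 : ℝ) ≤ n := by exact_mod_cast hn1
  have hn0 : (0 : ℝ) < n := by linarith
  simp only [Function.comp_apply] at hn
  rw [Real.rpow_sub hn0, Real.rpow_one, div_le_div_iff₀ hq (by positivity)] at hn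
  have h2 : ((n : ℝ) + 1) ^ p ≤ 2 * (n : ℝ) ^ p := by
    calc ((n : ℝ) + 1) ^ p ≤ (2 * (n : ℝ)) ^ p := by gcongr; linarith
      _ = 2 ^ p * (n : ℝ) ^ p := Real.mul_rpow (by norm_num) hn0.le
      _ ≤ 2 * (n : ℝ) ^ p := by
        gcongr
        simpa using Real.rpow_le_rpow_of_exponent_le (x := 2) (by norm_num) hp1.le
  rw [Real.rpow_neg (by positivity), ← div_eq_mul_inv,
    div_le_div_iff₀ hn0 (by positivity)]
  have : 0 < ((n : ℝ) + 1) ^ p := by positivity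
  nlinarith

lemma cSum_step {p q D : ℝ} (hp : 0 < p) (hq : 0 < q) (hD : (1 + q) / q ≤ D) {n : ℕ}
    (hn : 1 ≤ n) (hc : p / n ≤ q * ((n : ℝ) + 1) ^ (-p))
    (ih : cSum p q n ≤ D * (n : ℝ) ^ (-p)) :
    cSum p q (n + 1) ≤ D * ((n : ℝ) + 1) ^ (-p) := by
  have hn0 : (0 : ℝ) < n := by exact_mod_cast hn
  set t := ((n : ℝ) + 1) ^ (-p) with ht
  have ht0 : 0 < t := by positivity
  have ht1 : t ≤ 1 := Real.rpow_le_one_of_one_le_of_nonpos (by linarith) (by linarith)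
  have hD0 : 0 < D := lt_of_lt_of_le (by positivity) hD
  have hsq : ((n : ℝ) + 1) ^ (-(2 * p)) = t * t := by
    rw [ht, ← Real.rpow_add (by positivity)]; ring_nf
  have hratio : (n : ℝ) ^ (-p) ≤ Real.exp (q * t) * t := by
    have h1 : (((n : ℝ) + 1) / n) ^ p ≤ Real.exp (p / n) := by
      have : ((n : ℝ) + 1) / n ≤ Real.exp (1 / n) := by
        have := Real.add_one_le_exp (1 / (n : ℝ))
        calc ((n : ℝ) + 1) / n = 1 / n + 1 := by rw [add_div, div_self hn0.ne', add_comm]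
          _ ≤ _ := this
      calc (((n : ℝ) + 1) / n) ^ p ≤ (Real.exp (1 / n)) ^ p := by gcongr
        _ = Real.exp (p / n) := by rw [← Real.exp_mul]; ring_nf
    have h2 : (n : ℝ) ^ (-p) = (((n : ℝ) + 1) / n) ^ p * t := by
      rw [ht, Real.div_rpow (by positivity) hn0.le, Real.rpow_neg hn0.le,
        Real.rpow_neg (by positivity)]
      have : ((n : ℝ) + 1) ^ p ≠ 0 := by positivity
      field_simp
    rw [h2]
    gcongr
    exact h1.trans (Real.exp_le_exp.mpr hc)
  have hexp : Real.exp (-(q * t)) ≤ 1 / (1 + q * t) := by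
    rw [Real.exp_neg, ← one_div]
    gcongr
    linarith [Real.add_one_le_exp (q * t)]
  have hDq : 1 + q * t ≤ D * q := by
    rw [div_le_iff₀ hq] at hD
    nlinarith
  rw [cSum_succ, hsq]
  calc Real.exp (-(2 * q) * t) * cSum p q n + t * t
      ≤ Real.exp (-(2 * q) * t) * (D * (Real.exp (q * t) * t)) + t * t := by
        gcongr
        exact ih.trans (by gcongr)
    _ = (Real.exp (-(q * t)) * D + t) * t := by
        have : Real.exp (-(q * t)) = Real.exp (-(2 * q) * t) * Real.exp (q * t) := by
          rw [← Real.exp_add]; ring_nf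
        rw [this]; ring
    _ ≤ (1 / (1 + q * t) * D + t) * t := by gcongr
    _ ≤ D * t := by
        gcongr
        have : 0 < 1 + q * t := by positivity
        rw [div_mul_eq_mul_div, one_mul, div_add' _ _ _ this.ne', div_le_iff₀ this]
        nlinarith

lemma exists_cSum_le {p q : ℝ} (hp : p ∈ Set.Ioo (0 : ℝ) 1) (hq : 0 < q) :
    ∃ D : ℝ, 0 < D ∧ ∀ n : ℕ, 1 ≤ n → cSum p q n ≤ D * (n : ℝ) ^ (-p) := by
  obtain ⟨N, hN⟩ := Filter.eventually_atTop.mp (eventually_contraction hp hq)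
  set S := ∑ m ∈ Finset.Icc 1 (N + 1), cSum p q m * (m : ℝ) ^ p with hS
  have hterm : ∀ m ∈ Finset.Icc 1 (N + 1), 0 ≤ cSum p q m * (m : ℝ) ^ p := fun m hm =>
    mul_nonneg (cSum_pos p q (Finset.mem_Icc.mp hm).1).le (by positivity)
  have hS0 : 0 ≤ S := Finset.sum_nonneg hterm
  have hq1 : 0 < (1 + q) / q := by positivity
  have hsmall : ∀ n : ℕ, 1 ≤ n → n ≤ N + 1 →
      cSum p q n ≤ ((1 + q) / q + S) * (n : ℝ) ^ (-p) := by
    intro n hn hnN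
    have hn0 : (0 : ℝ) < n := by exact_mod_cast hn
    rw [Real.rpow_neg hn0.le, ← div_eq_mul_inv, le_div_iff₀ (by positivity)]
    have := Finset.single_le_sum hterm (Finset.mem_Icc.mpr ⟨hn, hnN⟩)
    linarith
  refine ⟨(1 + q) / q + S, by linarith, fun n hn => ?_⟩
  rcases le_total n (N + 1) with h | h
  · exact hsmall n hn h
  · induction n, h using Nat.le_induction with
    | base => exact hsmall _ hn le_rfl
    | succ n h ih =>
      have := cSum_step hp.1 hq (by linarith) (by omega) (hN n (by omega)) (ih (by omega))
      exact_mod_cast this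

/-- The maximum of `y ↦ y ^ s * exp (-b y)` on `[0, ∞)` is attained at `y = s / b`. -/
lemma rpow_mul_exp_neg_le {s b y : ℝ} (hs : 0 < s) (hb : 0 < b) (hy : 0 ≤ y) :
    y ^ s * Real.exp (-(b * y)) ≤ (s / (Real.exp 1 * b)) ^ s := by
  have h1 : y ≤ s / (Real.exp 1 * b) * Real.exp (b * y / s) := by
    have h := Real.add_one_le_exp (b * y / s - 1)
    rw [sub_add_cancel, Real.exp_sub, div_le_div_iff₀ hs (Real.exp_pos 1)] at h
    rw [div_mul_eq_mul_div, le_div_iff₀ (by positivity)]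
    linarith
  calc y ^ s * Real.exp (-(b * y))
      ≤ (s / (Real.exp 1 * b) * Real.exp (b * y / s)) ^ s * Real.exp (-(b * y)) := by gcongr
    _ = (s / (Real.exp 1 * b)) ^ s := by
      rw [Real.mul_rpow (by positivity) (by positivity), ← Real.exp_mul,
        div_mul_cancel₀ _ hs.ne', mul_assoc, ← Real.exp_add, add_neg_cancel, Real.exp_zero,
        mul_one]

/-- The constant in the tail bound for `∑ exp (-a n ^ p)`. -/
noncomputable def tailConst (p a κ : ℝ) : ℝ :=
  1 / (a * (1 - κ) * p) * ((1 - p) / p / (Real.exp 1 * (κ * a))) ^ ((1 - p) / p)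

lemma exp_neg_rpow_le_tailConst_mul {p a κ x : ℝ} (hp : p ∈ Set.Ioo (0 : ℝ) 1) (ha : 0 < a)
    (hκ : κ ∈ Set.Ioo (0 : ℝ) 1) (hx : 0 < x) :
    Real.exp (-(a * x ^ p)) ≤ tailConst p a κ *
      (Real.exp (-(a * (1 - κ)) * x ^ p) * (a * (1 - κ) * (p * x ^ (p - 1)))) := by
  obtain ⟨hp0, hp1⟩ := hp
  obtain ⟨hκ0, hκ1⟩ := hκ
  have hk : 0 < 1 - κ := by linarith
  have h := rpow_mul_exp_neg_le (s := (1 - p) / p) (b := κ * a) (y := x ^ p)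
    (div_pos (by linarith) hp0) (by positivity) (by positivity)
  have hpow : (x ^ p) ^ ((1 - p) / p) = x ^ (1 - p) := by
    rw [← Real.rpow_mul hx.le, mul_div_cancel₀ _ hp0.ne']
  have hinv : x ^ (1 - p) * x ^ (p - 1) = 1 := by
    rw [← Real.rpow_add hx]; simp
  have hsplit : Real.exp (-(a * x ^ p)) =
      Real.exp (-(κ * a * x ^ p)) * Real.exp (-(a * (1 - κ)) * x ^ p) := by
    rw [← Real.exp_add]; ring_nf
  rw [hpow] at h
  unfold tailConst
  set M := ((1 - p) / p / (Real.exp 1 * (κ * a))) ^ ((1 - p) / p)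
  calc Real.exp (-(a * x ^ p))
      = (x ^ (1 - p) * Real.exp (-(κ * a * x ^ p))) *
          (Real.exp (-(a * (1 - κ)) * x ^ p) * x ^ (p - 1)) := by
        rw [hsplit]; linear_combination
          -(Real.exp (-(κ * a * x ^ p)) * Real.exp (-(a * (1 - κ)) * x ^ p)) * hinv
    _ ≤ M * (Real.exp (-(a * (1 - κ)) * x ^ p) * x ^ (p - 1)) := by gcongr
    _ = _ := by field_simp

lemma exp_neg_natCast_rpow_le_sub {p a κ : ℝ} (hp : p ∈ Set.Ioo (0 : ℝ) 1) (ha : 0 < a)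
    (hκ : κ ∈ Set.Ioo (0 : ℝ) 1) {n : ℕ} (hn : 1 ≤ n) :
    Real.exp (-(a * (n : ℝ) ^ p)) ≤ Real.exp a * tailConst p a κ *
      (Real.exp (-(a * (1 - κ)) * (n : ℝ) ^ p) -
        Real.exp (-(a * (1 - κ)) * ((n + 1 : ℕ) : ℝ) ^ p)) := by
  have hn0 : (0 : ℝ) < n := by exact_mod_cast hn
  have hderiv : ∀ x : ℝ, 0 < x → HasDerivAt (fun x => Real.exp (-(a * (1 - κ)) * x ^ p))
      (Real.exp (-(a * (1 - κ)) * x ^ p) * (-(a * (1 - κ)) * (p * x ^ (p - 1)))) x :=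
    fun x hx => (((Real.hasDerivAt_rpow_const (Or.inl hx.ne')).const_mul _).exp)
  obtain ⟨ξ, hξ, hslope⟩ := exists_hasDerivAt_eq_slope
    (fun x => Real.exp (-(a * (1 - κ)) * x ^ p)) _ (lt_add_one (n : ℝ))
    (fun x hx => (hderiv x (hn0.trans_le hx.1)).continuousAt.continuousWithinAt)
    (fun x hx => hderiv x (hn0.trans hx.1))
  have hξ0 : 0 < ξ := hn0.trans hξ.1
  have hpow : ξ ^ p ≤ (n : ℝ) ^ p + 1 := by
    calc ξ ^ p ≤ ((n : ℝ) + 1) ^ p := Real.rpow_le_rpow hξ0.le hξ.2.le hp.1.le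
      _ ≤ (n : ℝ) ^ p + 1 ^ p :=
        Real.rpow_add_le_add_rpow hn0.le zero_le_one hp.1.le hp.2.le
      _ = _ := by rw [Real.one_rpow]
  have h := exp_neg_rpow_le_tailConst_mul hp ha hκ hξ0
  rw [add_sub_cancel_left, div_one] at hslope
  have heq : Real.exp (-(a * (1 - κ)) * ξ ^ p) * (a * (1 - κ) * (p * ξ ^ (p - 1))) =
      Real.exp (-(a * (1 - κ)) * (n : ℝ) ^ p) -
        Real.exp (-(a * (1 - κ)) * ((n + 1 : ℕ) : ℝ) ^ p) := by
    push_cast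
    linear_combination -hslope
  rw [heq] at h
  calc Real.exp (-(a * (n : ℝ) ^ p)) ≤ Real.exp a * Real.exp (-(a * ξ ^ p)) := by
        rw [← Real.exp_add]
        apply Real.exp_le_exp.mpr
        nlinarith
    _ ≤ _ := by rw [mul_assoc]; gcongr

lemma tailConst_nonneg {p a κ : ℝ} (hp : p ∈ Set.Ioo (0 : ℝ) 1) (ha : 0 < a)
    (hκ : κ ∈ Set.Ioo (0 : ℝ) 1) : 0 ≤ tailConst p a κ := by
  have h1 : 0 < 1 - p := sub_pos.mpr hp.2
  have h2 : 0 < 1 - κ := sub_pos.mpr hκ.2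
  have h3 := hp.1
  have h4 := hκ.1
  unfold tailConst
  positivity

lemma tailConst_eq {p a κ : ℝ} (hp : p ∈ Set.Ioo (0 : ℝ) 1) (ha : 0 < a)
    (hκ : κ ∈ Set.Ioo (0 : ℝ) 1) :
    tailConst p a κ = (1 / a) ^ (1 / p) * (1 / ((1 - κ) * p ^ (1 / p))) *
      ((1 - p) / (Real.exp 1 * κ)) ^ ((1 - p) / p) := by
  have h1 : 0 < 1 - p := sub_pos.mpr hp.2
  have h2 : 0 < 1 - κ := sub_pos.mpr hκ.2
  have hp0 := hp.1
  have hκ0 := hκ.1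
  have hs : (1 - p) / p = 1 / p - 1 := by field_simp
  unfold tailConst
  have hsplit : (1 - p) / p / (Real.exp 1 * (κ * a)) =
      (1 - p) / (Real.exp 1 * κ) * (1 / (p * a)) := by field_simp
  have hpow : (1 / (p * a)) ^ ((1 - p) / p) = (1 / a) ^ (1 / p) * (1 / p ^ (1 / p)) * (p * a) := by
    rw [hs, Real.rpow_sub (by positivity), Real.rpow_one, Real.div_rpow zero_le_one ha.le,
      Real.div_rpow zero_le_one (by positivity), Real.mul_rpow hp0.le ha.le, Real.one_rpow]
    field_simp
  rw [hsplit, Real.mul_rpow (by positivity) (by positivity), hpow]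
  field_simp

/-- A series whose terms are dominated by the decrements of a nonnegative sequence. -/
lemma tsum_subtype_le_of_le_sub {f G : ℕ → ℝ} {n₀ : ℕ} (hf : ∀ n, n₀ ≤ n → 0 ≤ f n)
    (hG : ∀ n, 0 ≤ G n) (hfG : ∀ n, n₀ ≤ n → f n ≤ G n - G (n + 1)) :
    ∑' n : {k : ℕ // n₀ ≤ k}, f n ≤ G n₀ := by
  have hind : ∑' n : {k : ℕ // n₀ ≤ k}, f n = ∑' n, Set.indicator {k | n₀ ≤ k} f n :=
    tsum_subtype {k | n₀ ≤ k} f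
  rw [hind]
  refine Real.tsum_le_of_sum_range_le (Set.indicator_nonneg hf) fun N => ?_
  suffices h : ∑ n ∈ Finset.range N, Set.indicator {k | n₀ ≤ k} f n ≤ G n₀ - G (max n₀ N) by
    linarith [hG (max n₀ N)]
  induction N with
  | zero => simp
  | succ N ih =>
    rw [Finset.sum_range_succ]
    rcases le_or_gt n₀ N with h | h
    · rw [Set.indicator_of_mem (show N ∈ {k | n₀ ≤ k} from h), max_eq_right (by omega)]
      rw [max_eq_right h] at ih
      linarith [hfG N h]
    · rw [Set.indicator_of_notMem (show N ∉ {k | n₀ ≤ k} from not_le.mpr h), add_zero,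
        max_eq_left (by omega)]
      rwa [max_eq_left h.le] at ih

/-- Closed-form sub-exponential bound: with
`c_n := ∑_{k=0}^{n−1} (k+1)^{−2p} exp(−2q̂ ∑_{i=k+1}^{n−1}(i+1)^{−p})`, there is a constant
`K_g ≥ 1` depending only on `p` and `q̂` such that for all `c > 0`, `κ ∈ (0,1)`, `ε > 0` and
integers `n0 ≥ 1`, `∑_{n ≥ n0} exp(−c ε²/c_n) ≤ (c7/ε^{2/p}) exp(c5 ε²) exp(−c6 ε² n0^p)`,
where `c5 = c q̂ (2−κ)/(K_g e^{q̂})`, `c6 = c q̂ (1−κ)/(K_g e^{q̂})` and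
`c7 = 2 (K_g e^{q̂}/(c q̂))^{1/p} (1/((1−κ) p^{1/p})) ((1−p)/(eκ))^{(1−p)/p}`. -/
theorem subexponential_series_cn_bound (p qhat : ℝ)
    (hp : p ∈ Set.Ioo (0:ℝ) 1) (hq : 0 < qhat) :
    ∃ Kg : ℝ, 1 ≤ Kg ∧
      ∀ c κ ε : ℝ, 0 < c → κ ∈ Set.Ioo (0:ℝ) 1 → 0 < ε → ∀ n0 : ℕ, 1 ≤ n0 →
        (∑' n : {k : ℕ // n0 ≤ k},
            Real.exp (-(c * ε ^ 2) /
              (∑ k ∈ Finset.range (n : ℕ), ((k : ℝ) + 1) ^ (-(2 * p)) *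
                Real.exp (-(2 * qhat) *
                  ∑ i ∈ Finset.Ico (k + 1) (n : ℕ), ((i : ℝ) + 1) ^ (-p)))))
          ≤ (2 * (Kg * Real.exp qhat / (c * qhat)) ^ (1 / p) *
                (1 / ((1 - κ) * p ^ (1 / p))) *
                ((1 - p) / (Real.exp 1 * κ)) ^ ((1 - p) / p)) / ε ^ (2 / p) *
              Real.exp ((c * qhat * (2 - κ) / (Kg * Real.exp qhat)) * ε ^ 2) *
              Real.exp (-(c * qhat * (1 - κ) / (Kg * Real.exp qhat)) * ε ^ 2 * (n0 : ℝ) ^ p) := by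
  obtain ⟨D, hD, hcD⟩ := exists_cSum_le hp hq
  refine ⟨max 1 (D * qhat), le_max_left _ _, ?_⟩
  intro c κ ε hc hκ hε n0 hn0
  set K := max 1 (D * qhat) with hK
  have hK0 : 0 < K := lt_of_lt_of_le one_pos (le_max_left _ _)
  have hKD : D * qhat ≤ K * Real.exp qhat :=
    (le_max_right _ _).trans (le_mul_of_one_le_right hK0.le (Real.one_le_exp hq.le))
  set a := c * qhat / (K * Real.exp qhat) * ε ^ 2 with ha_def
  have ha : 0 < a := by positivity
  have haD : a ≤ c * ε ^ 2 / D := by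
    rw [ha_def, div_mul_eq_mul_div, div_le_div_iff₀ (by positivity) hD]
    have : 0 < c * ε ^ 2 := by positivity
    nlinarith
  have hT := tailConst_nonneg hp ha hκ
  have hbound : ∀ n : ℕ, n0 ≤ n →
      Real.exp (-(c * ε ^ 2) / cSum p qhat n) ≤ Real.exp (-(a * (n : ℝ) ^ p)) := by
    intro n hn
    have hn1 : 1 ≤ n := hn0.trans hn
    have hnpos : (0 : ℝ) < n := by exact_mod_cast hn1
    apply Real.exp_le_exp.mpr
    rw [neg_div, neg_le_neg_iff, le_div_iff₀ (cSum_pos p qhat hn1)]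
    calc a * (n : ℝ) ^ p * cSum p qhat n
        ≤ c * ε ^ 2 / D * (n : ℝ) ^ p * (D * (n : ℝ) ^ (-p)) := by
          gcongr
          exacts [(cSum_pos p qhat hn1).le, hcD n hn1]
      _ = c * ε ^ 2 := by
          rw [Real.rpow_neg hnpos.le]
          have : (n : ℝ) ^ p ≠ 0 := by positivity
          field_simp
  have hsum := tsum_subtype_le_of_le_sub
    (f := fun n => Real.exp (-(c * ε ^ 2) / cSum p qhat n))
    (G := fun n => Real.exp a * tailConst p a κ * Real.exp (-(a * (1 - κ)) * (n : ℝ) ^ p))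
    (n₀ := n0) (fun n _ => (Real.exp_pos _).le) (fun n => by positivity)
    (fun n hn => by
      rw [← mul_sub]
      exact (hbound n hn).trans (exp_neg_natCast_rpow_le_sub hp ha hκ (hn0.trans hn)))
  refine hsum.trans ?_
  have hconst : (2 * (K * Real.exp qhat / (c * qhat)) ^ (1 / p) *
      (1 / ((1 - κ) * p ^ (1 / p))) *
      ((1 - p) / (Real.exp 1 * κ)) ^ ((1 - p) / p)) / ε ^ (2 / p) = 2 * tailConst p a κ := by
    have h1 : 1 / a = K * Real.exp qhat / (c * qhat) / ε ^ 2 := by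
      rw [ha_def]; field_simp
    have h2 : (ε ^ 2) ^ (1 / p) = ε ^ (2 / p) := by
      rw [← Real.rpow_natCast, ← Real.rpow_mul hε.le]; ring_nf
    rw [tailConst_eq hp ha hκ, h1,
      Real.div_rpow (x := K * Real.exp qhat / (c * qhat)) (by positivity) (by positivity), h2]
    ring
  have he1 : c * qhat * (2 - κ) / (K * Real.exp qhat) * ε ^ 2 = a * (2 - κ) := by
    rw [ha_def]; ring
  have he2 : -(c * qhat * (1 - κ) / (K * Real.exp qhat)) * ε ^ 2 * (n0 : ℝ) ^ p =
      -(a * (1 - κ)) * (n0 : ℝ) ^ p := by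
    rw [ha_def]; ring
  rw [hconst, he1, he2]
  have hκ1 := hκ.2
  have hexp : Real.exp a ≤ Real.exp (a * (2 - κ)) := Real.exp_le_exp.mpr (by nlinarith)
  refine mul_le_mul_of_nonneg_right ?_ (Real.exp_pos _).le
  calc Real.exp a * tailConst p a κ ≤ Real.exp (a * (2 - κ)) * (2 * tailConst p a κ) := by
        gcongr
        linarith
    _ = _ := mul_comm _ _
end

section
/- Let p ∈ (0,1) and q̂ > 0. Then there exists a constant K_g ≥ 1 such that for every integer n ≥ 1: max_{0 ≤ i ≤ n−1} (i+1)^{−p} · exp(−q̂ ∑_{k=i+1}^{n−1} (k+1)^{−p}) ≤ K_g · n^{−p}. -/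
open Real Finset

/-- Since `p < 1`, multiplying by `exp (-q (n+1)^{-p})` eventually offsets the growth of `n ^ p`. -/
lemma exists_forall_rpow_succ_mul_exp_le {p q : ℝ} (hp1 : p < 1) (hq : 0 < q) :
    ∃ N : ℕ, 1 ≤ N ∧ ∀ n : ℕ, N ≤ n →
      ((n : ℝ) + 1) ^ p * Real.exp (-q * ((n : ℝ) + 1) ^ (-p)) ≤ (n : ℝ) ^ p := by
  obtain ⟨a, ha⟩ := Filter.eventually_atTop.1
    ((tendsto_rpow_neg_atTop (sub_pos.2 hp1)).eventually_le_const (half_pos hq))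
  refine ⟨max 1 ⌈a⌉₊, le_max_left _ _, fun n hn ↦ ?_⟩
  have hn1 : (1 : ℝ) ≤ n := by exact_mod_cast (le_max_left _ _).trans hn
  have hna : a ≤ n := Nat.ceil_le.1 ((le_max_right _ _).trans hn)
  have hn0 : (0 : ℝ) < n := by linarith
  have hpos : 0 < ((n : ℝ) + 1) ^ p := by positivity
  have hbound := ha ((n : ℝ) + 1) (by linarith)
  rw [neg_sub, rpow_sub_one (by positivity), div_le_iff₀ (by positivity)] at hbound
  have hgrowth : ((n : ℝ) + 1) ^ p ≤ q * n := by nlinarith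
  have hinv : 1 / (n : ℝ) ≤ q * ((n : ℝ) + 1) ^ (-p) := by
    rw [rpow_neg (by positivity), ← div_eq_mul_inv, div_le_div_iff₀ hn0 hpos]
    linarith
  have hratio : (((n : ℝ) + 1) / n) ^ p ≤ Real.exp (q * ((n : ℝ) + 1) ^ (-p)) := by
    calc (((n : ℝ) + 1) / n) ^ p ≤ (((n : ℝ) + 1) / n) ^ (1 : ℝ) :=
          rpow_le_rpow_of_exponent_le ((one_le_div hn0).2 (by linarith)) hp1.le
      _ = 1 / (n : ℝ) + 1 := by rw [rpow_one]; field_simp; ring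
      _ ≤ q * ((n : ℝ) + 1) ^ (-p) + 1 := by linarith
      _ ≤ _ := add_one_le_exp _
  rw [div_rpow (by positivity) hn0.le, div_le_iff₀ (by positivity)] at hratio
  rw [neg_mul, Real.exp_neg, ← div_eq_mul_inv, div_le_iff₀ (Real.exp_pos _)]
  linarith

/-- There is a constant `K_g ≥ 1` (depending only on `p` and `q̂`) such that for every
integer `n ≥ 1`, `max_{0 ≤ i ≤ n−1} (i+1)^{−p} exp(−q̂ ∑_{k=i+1}^{n−1} (k+1)^{−p}) ≤ K_g n^{−p}`. -/
theorem exists_Kg_bound (p qhat : ℝ) (hp : p ∈ Set.Ioo (0:ℝ) 1) (hq : 0 < qhat) :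
    ∃ Kg : ℝ, 1 ≤ Kg ∧ ∀ n : ℕ, 1 ≤ n → ∀ i : ℕ, i < n →
      ((i : ℝ) + 1) ^ (-p) *
          Real.exp (-qhat * ∑ k ∈ Finset.Ico (i + 1) n, ((k : ℝ) + 1) ^ (-p))
        ≤ Kg * (n : ℝ) ^ (-p) := by
  obtain ⟨N, hN, hstep⟩ := exists_forall_rpow_succ_mul_exp_le hp.2 hq
  have hK : (1 : ℝ) ≤ (N : ℝ) ^ p := one_le_rpow (by exact_mod_cast hN) hp.1.le
  refine ⟨(N : ℝ) ^ p, hK, fun n hn i hi ↦ ?_⟩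
  have hi1 : (1 : ℝ) ≤ ((i : ℝ) + 1) ^ p := one_le_rpow (by simp) hp.1.le
  have key : (n : ℝ) ^ p *
      Real.exp (-qhat * ∑ k ∈ Finset.Ico (i + 1) n, ((k : ℝ) + 1) ^ (-p))
        ≤ (N : ℝ) ^ p * ((i : ℝ) + 1) ^ p := by
    clear hn
    induction n, (Nat.succ_le_of_lt hi) using Nat.le_induction with
    | base => simpa using le_mul_of_one_le_left (zero_le_one.trans hi1) hK
    | succ n hmn ih =>
      rcases lt_or_ge n N with h | h
      · have hnN : ((n + 1 : ℕ) : ℝ) ^ p ≤ (N : ℝ) ^ p :=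
          rpow_le_rpow (by positivity) (by exact_mod_cast h) hp.1.le
        have hsum : 0 ≤ ∑ k ∈ Finset.Ico (i + 1) (n + 1), ((k : ℝ) + 1) ^ (-p) :=
          sum_nonneg fun k _ ↦ by positivity
        have hexp : Real.exp
            (-qhat * ∑ k ∈ Finset.Ico (i + 1) (n + 1), ((k : ℝ) + 1) ^ (-p)) ≤ 1 :=
          exp_le_one_iff.2 (by nlinarith)
        exact mul_le_mul hnN (hexp.trans hi1) (Real.exp_pos _).le (by positivity)
      · rw [sum_Ico_succ_top hmn, mul_add, Real.exp_add, mul_left_comm, mul_comm]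
        push_cast
        refine le_trans ?_ (ih hmn)
        exact mul_le_mul_of_nonneg_right (hstep n h) (Real.exp_pos _).le
  rw [rpow_neg (by positivity), rpow_neg (by positivity), inv_mul_eq_div, ← div_eq_mul_inv,
    div_le_div_iff₀ (by positivity) (rpow_pos_of_pos (by exact_mod_cast hn) p)]
  linarith
end

section
/- Let p ∈ (0,1), q̂ > 0, and let K_g ≥ 1 be a constant such that for every integer n ≥ 1, max_{0 ≤ i ≤ n−1} (i+1)^{−p} · exp(−q̂ ∑_{k=i+1}^{n−1} (k+1)^{−p}) ≤ K_g n^{−p}. Then for every integer n ≥ 1: c_n := ∑_{k=0}^{n−1} (k+1)^{−2p} · exp(−2q̂ ∑_{i=k+1}^{n−1} (i+1)^{−p}) ≤ (K_g e^{q̂}/q̂) · n^{−p}. -/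
open Real Finset

/-- A discounted sum of weights in `[0, 1]` with discount factors `exp (-q * a i)` is at most
`exp q / q`. -/
theorem mul_sum_mul_exp_neg_sum_Ico_le_exp {a : ℕ → ℝ} {q : ℝ} (hq : 0 ≤ q)
    (ha₀ : ∀ k, 0 ≤ a k) (ha₁ : ∀ k, a k ≤ 1) (n : ℕ) :
    q * ∑ k ∈ Finset.range n, a k * Real.exp (-q * ∑ i ∈ Finset.Ico (k + 1) n, a i)
      ≤ Real.exp q := by
  induction n with
  | zero => simpa using (Real.exp_pos q).le
  | succ n ih =>
    have hrec : ∑ k ∈ Finset.range (n + 1),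
          a k * Real.exp (-q * ∑ i ∈ Finset.Ico (k + 1) (n + 1), a i)
        = (∑ k ∈ Finset.range n, a k * Real.exp (-q * ∑ i ∈ Finset.Ico (k + 1) n, a i))
            * Real.exp (-q * a n) + a n := by
      rw [Finset.sum_range_succ, Finset.sum_mul]
      congr 1
      · refine Finset.sum_congr rfl fun k hk => ?_
        rw [Finset.sum_Ico_succ_top (Finset.mem_range.mp hk), mul_add, Real.exp_add, mul_assoc]
      · simp
    have hqa : 0 ≤ q * a n := mul_nonneg hq (ha₀ n)
    have hone : 1 ≤ Real.exp (q - q * a n) :=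
      Real.one_le_exp (sub_nonneg.mpr (mul_le_of_le_one_right hq (ha₁ n)))
    have hdiscount : Real.exp q * Real.exp (-q * a n) = Real.exp (q - q * a n) := by
      rw [← Real.exp_add]; ring_nf
    have hsplit : Real.exp q = Real.exp (q - q * a n) * Real.exp (q * a n) := by
      rw [← Real.exp_add]; ring_nf
    rw [hrec, mul_add, ← mul_assoc]
    calc _ ≤ Real.exp q * Real.exp (-q * a n) + q * a n := by gcongr
      _ = Real.exp (q - q * a n) + q * a n := by rw [hdiscount]
      _ ≤ Real.exp (q - q * a n) * (q * a n + 1) := by nlinarith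
      _ ≤ Real.exp q := by
        rw [hsplit]
        gcongr
        exact Real.add_one_le_exp _

/-- If `K_g ≥ 1` satisfies `max_{0 ≤ i ≤ n−1} (i+1)^{−p} exp(−q̂ ∑_{k=i+1}^{n−1} (k+1)^{−p})
≤ K_g n^{−p}` for all `n ≥ 1`, then
`c_n = ∑_{k=0}^{n−1} (k+1)^{−2p} exp(−2q̂ ∑_{i=k+1}^{n−1}(i+1)^{−p}) ≤ (K_g e^{q̂}/q̂) n^{−p}`. -/
theorem cn_bound (p qhat Kg : ℝ) (hp : p ∈ Set.Ioo (0:ℝ) 1) (hq : 0 < qhat)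
    (hKg : 1 ≤ Kg)
    (hmax : ∀ n : ℕ, 1 ≤ n → ∀ i : ℕ, i < n →
      ((i : ℝ) + 1) ^ (-p) *
          Real.exp (-qhat * ∑ k ∈ Finset.Ico (i + 1) n, ((k : ℝ) + 1) ^ (-p))
        ≤ Kg * (n : ℝ) ^ (-p)) :
    ∀ n : ℕ, 1 ≤ n →
      (∑ k ∈ Finset.range n, ((k : ℝ) + 1) ^ (-(2 * p)) *
          Real.exp (-(2 * qhat) * ∑ i ∈ Finset.Ico (k + 1) n, ((i : ℝ) + 1) ^ (-p)))
        ≤ (Kg * Real.exp qhat / qhat) * (n : ℝ) ^ (-p) := by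
  intro n hn
  have hsum := mul_sum_mul_exp_neg_sum_Ico_le_exp (a := fun k : ℕ => ((k : ℝ) + 1) ^ (-p)) hq.le
    (fun k => by positivity)
    (fun k => Real.rpow_le_one_of_one_le_of_nonpos (by simp) (neg_nonpos.mpr hp.1.le)) n
  rw [mul_comm, ← le_div_iff₀ hq] at hsum
  have hn₀ : 0 ≤ Kg * (n : ℝ) ^ (-p) := by positivity
  calc _ ≤ ∑ k ∈ Finset.range n, Kg * (n : ℝ) ^ (-p) * (((k : ℝ) + 1) ^ (-p) *
          Real.exp (-qhat * ∑ i ∈ Finset.Ico (k + 1) n, ((i : ℝ) + 1) ^ (-p))) := by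
        refine Finset.sum_le_sum fun k hk => ?_
        have hpow : ((k : ℝ) + 1) ^ (-(2 * p)) = ((k : ℝ) + 1) ^ (-p) * ((k : ℝ) + 1) ^ (-p) := by
          rw [← Real.rpow_add (by positivity)]; ring_nf
        rw [hpow, show -(2 * qhat) = -qhat + -qhat by ring, add_mul, Real.exp_add,
          mul_mul_mul_comm]
        exact mul_le_mul_of_nonneg_right (hmax n hn k (Finset.mem_range.mp hk)) (by positivity)
    _ ≤ Kg * (n : ℝ) ^ (-p) * (Real.exp qhat / qhat) := by
        rw [← Finset.mul_sum]
        exact mul_le_mul_of_nonneg_left hsum hn₀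
    _ = _ := by ring
end

section
/- Let {α_k}, {β_k} be positive sequences with α_k ≤ β_k for all k, set t_n := ∑_{k<n} α_k and s_n := ∑_{k<n} β_k, and let ξ be the piecewise-linear map with ξ(t_k) = s_k and slope β_k/α_k on each interval [t_k, t_{k+1}]. Let q1, q2 > 0, q_min := min(q1, q2), and q ∈ (0, q_min). Then for all integers n ≥ n0 ≥ 0: ∑_{k=n0}^{n−1} ∫_{t_k}^{t_{k+1}} e^{−q1(t_n − τ)} · e^{−q2(ξ(τ) − s_{n0})} dτ ≤ (1/((q_min − q)·e)) · e^{−q(t_n − t_{n0})}. -/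
open Real Finset

/-- The maximum over `T` of `T * exp (-(c * T))` is `1 / (c * e)`. -/
lemma mul_exp_neg_mul_le {c : ℝ} (hc : 0 < c) (T : ℝ) :
    T * Real.exp (-(c * T)) ≤ 1 / (c * Real.exp 1) := by
  have h : c * T ≤ Real.exp (c * T - 1) := by
    linarith [Real.add_one_le_exp (c * T - 1)]
  rw [le_div_iff₀ (by positivity)]
  calc T * Real.exp (-(c * T)) * (c * Real.exp 1)
      = c * T * (Real.exp (-(c * T)) * Real.exp 1) := by ring
    _ ≤ Real.exp (c * T - 1) * (Real.exp (-(c * T)) * Real.exp 1) := by gcongr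
    _ = 1 := by
      rw [← Real.exp_add, ← Real.exp_add, Real.exp_eq_one_iff]
      ring

/-- **Dominating decay rate bound.** With `t_n = ∑_{k<n} α_k`, `s_n = ∑_{k<n} β_k`,
`ξ` the piecewise-linear map with `ξ(t_k) = s_k` and slope `β_k/α_k` on `[t_k, t_{k+1}]`,
`0 < q < q_min = min(q1,q2)`, for all `n ≥ n0`:
`∑_{k=n0}^{n−1} ∫_{t_k}^{t_{k+1}} e^{−q1(t_n−τ)} e^{−q2(ξ(τ)−s_{n0})} dτ
  ≤ e^{−q(t_n−t_{n0})}/((q_min−q)e)`. -/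
theorem dominating_decay_rate_bound
    (α β : ℕ → ℝ) (hα : ∀ k, 0 < α k) (hβ : ∀ k, 0 < β k)
    (hαβ : ∀ k, α k ≤ β k)
    (t s : ℕ → ℝ)
    (ht : ∀ n, t n = ∑ k ∈ Finset.range n, α k)
    (hs : ∀ n, s n = ∑ k ∈ Finset.range n, β k)
    (ξ : ℝ → ℝ)
    (hξ : ∀ k : ℕ, ∀ τ ∈ Set.Icc (t k) (t (k + 1)),
      ξ τ = s k + (β k / α k) * (τ - t k))
    (q1 q2 q : ℝ) (hq1 : 0 < q1) (hq2 : 0 < q2) (hq : q ∈ Set.Ioo 0 (min q1 q2))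
    (n0 n : ℕ) (hn : n0 ≤ n) :
    (∑ k ∈ Finset.Ico n0 n,
        ∫ τ in (t k)..(t (k + 1)),
          Real.exp (-(q1 * (t n - τ))) * Real.exp (-(q2 * (ξ τ - s n0))))
      ≤ (1 / ((min q1 q2 - q) * Real.exp 1)) * Real.exp (-(q * (t n - t n0))) := by
  obtain ⟨-, hqm⟩ := hq
  have t_succ (k : ℕ) : t (k + 1) = t k + α k := by rw [ht, ht, Finset.sum_range_succ]
  have s_succ (k : ℕ) : s (k + 1) = s k + β k := by rw [hs, hs, Finset.sum_range_succ]
  have t_mono : Monotone t := monotone_nat_of_le_succ fun k => by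
    linarith [t_succ k, hα k]
  have gap_mono : Monotone fun k => s k - t k := monotone_nat_of_le_succ fun k => by
    linarith [t_succ k, s_succ k, hαβ k]
  set m := min q1 q2
  set T := t n - t n0
  have integral_le (k : ℕ) (hk : k ∈ Finset.Ico n0 n) :
      ∫ τ in (t k)..(t (k + 1)),
          Real.exp (-(q1 * (t n - τ))) * Real.exp (-(q2 * (ξ τ - s n0)))
        ≤ Real.exp (-(m * T)) * (t (k + 1) - t k) := by
    obtain ⟨hk0, hkn⟩ := Finset.mem_Ico.mp hk
    have hle : t k ≤ t (k + 1) := t_mono k.le_succ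
    rw [← abs_of_nonneg (sub_nonneg.mpr hle)]
    refine (Real.le_norm_self _).trans
      (intervalIntegral.norm_integral_le_of_norm_le_const fun τ hτ => ?_)
    rw [Set.uIoc_of_le hle] at hτ
    rw [← Real.exp_add, Real.norm_of_nonneg (Real.exp_pos _).le]
    apply Real.exp_le_exp.mpr
    have hξτ := hξ k τ ⟨hτ.1.le, hτ.2⟩
    have slope : 1 ≤ β k / α k := (one_le_div (hα k)).mpr (hαβ k)
    have hslope : τ - t k ≤ β k / α k * (τ - t k) :=
      le_mul_of_one_le_left (sub_nonneg.mpr hτ.1.le) slope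
    have hgap : s n0 - t n0 ≤ s k - t k := gap_mono hk0
    have h0 : 0 ≤ τ - t n0 := by linarith [t_mono hk0, hτ.1]
    have h1 : 0 ≤ t n - τ := by linarith [t_mono (Nat.succ_le_of_lt hkn), hτ.2]
    have h2 : q2 * (τ - t n0) ≤ q2 * (ξ τ - s n0) :=
      mul_le_mul_of_nonneg_left (by linarith) hq2.le
    have h3 : m * (t n - τ) ≤ q1 * (t n - τ) :=
      mul_le_mul_of_nonneg_right (min_le_left _ _) h1
    have h4 : m * (τ - t n0) ≤ q2 * (τ - t n0) :=
      mul_le_mul_of_nonneg_right (min_le_right _ _) h0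
    have h5 : m * T = m * (t n - τ) + m * (τ - t n0) := by ring
    linarith
  calc _ ≤ ∑ k ∈ Finset.Ico n0 n, Real.exp (-(m * T)) * (t (k + 1) - t k) :=
        Finset.sum_le_sum integral_le
    _ = T * Real.exp (-((m - q) * T)) * Real.exp (-(q * T)) := by
        rw [← Finset.mul_sum, Finset.sum_Ico_sub t hn, mul_assoc, ← Real.exp_add, mul_comm]
        congr 2
        ring
    _ ≤ _ := by
        gcongr
        exact mul_exp_neg_mul_le (sub_pos.mpr hqm) T
end
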